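/- arXiv:2507.00221 — 2 statements merged into one kernel-verified Lean document; each statement's English description precedes it below -/
import Mathlib

section
/- For every lower bounded distributive lattice D, the module of motives M(D) is a free abelian group. -/
open scoped Classical

/-- The subgroup of relators defining the module of motives of a lower bounded
distributive lattice `D`: generated by `[⊥]` and the modularity relators
`[U] + [V] - [U ⊔ V] - [U ⊓ V]`. -/
def motiveRelators (D : Type*) [DistribLattice D] [OrderBot D] :
    AddSubgroup (FreeAbelianGroup D) :=
  AddSubgroup.closure
    ({FreeAbelianGroup.of (⊥ : D)} ∪
      {x | ∃ U V : D, x = FreeAbelianGroup.of U + FreeAbelianGroup.of V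
          - FreeAbelianGroup.of (U ⊔ V) - FreeAbelianGroup.of (U ⊓ V)})

/-- The module of motives `M(D)` of a lower bounded distributive lattice `D`: the
free abelian group on `D` modulo `[⊥] = 0` and `[U] + [V] = [U ⊔ V] + [U ⊓ V]`. -/
def Motive (D : Type*) [DistribLattice D] [OrderBot D] : Type _ :=
  FreeAbelianGroup D ⧸ motiveRelators D

noncomputable instance (D : Type*) [DistribLattice D] [OrderBot D] :
    AddCommGroup (Motive D) :=
  QuotientAddGroup.Quotient.addCommGroup (motiveRelators D)

/-- The universal valuation `D → M(D)`, `U ↦ [U]`. -/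
def motiveOf {D : Type*} [DistribLattice D] [OrderBot D] (U : D) : Motive D :=
  QuotientAddGroup.mk (FreeAbelianGroup.of U)

/-- A valuation on a lower bounded distributive lattice with values in an abelian
group: `μ ⊥ = 0` and modularity `μ U + μ V = μ (U ⊔ V) + μ (U ⊓ V)`. -/
def IsValuation {D A : Type*} [DistribLattice D] [OrderBot D] [AddCommGroup A]
    (μ : D → A) : Prop :=
  μ ⊥ = 0 ∧ ∀ U V : D, μ U + μ V = μ (U ⊔ V) + μ (U ⊓ V)

namespace MotiveAux

variable {D : Type*} [DistribLattice D] [OrderBot D]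

theorem motiveOf_bot : motiveOf (⊥ : D) = 0 := by
  refine (QuotientAddGroup.eq_zero_iff _).2 (AddSubgroup.subset_closure (Or.inl rfl))

theorem motiveOf_add (U V : D) :
    motiveOf U + motiveOf V = motiveOf (U ⊔ V) + motiveOf (U ⊓ V) := by
  have h : (QuotientAddGroup.mk (FreeAbelianGroup.of U + FreeAbelianGroup.of V
      - FreeAbelianGroup.of (U ⊔ V) - FreeAbelianGroup.of (U ⊓ V)) : Motive D) = 0 :=
    (QuotientAddGroup.eq_zero_iff _).2 (AddSubgroup.subset_closure (Or.inr ⟨U, V, rfl⟩))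
  have h2 : motiveOf U + motiveOf V - motiveOf (U ⊔ V) - motiveOf (U ⊓ V) = 0 := h
  rw [sub_sub] at h2
  exact sub_eq_zero.1 h2

/-- The space of zero-preserving lattice characters. -/
def Chars (D : Type*) [DistribLattice D] [OrderBot D] : Set (D → Bool) :=
  {f | f ⊥ = false ∧ ∀ U V, f (U ⊔ V) = (f U || f V) ∧ f (U ⊓ V) = (f U && f V)}

theorem isClosed_chars : IsClosed (Chars D) := by
  have : Chars D = {f | f ⊥ = false} ∩ ⋂ U : D, ⋂ V : D,
      ({f : D → Bool | f (U ⊔ V) = (f U || f V)} ∩ {f | f (U ⊓ V) = (f U && f V)}) := by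
    ext f
    simp [Chars]
  rw [this]
  refine IsClosed.inter (isClosed_eq (continuous_apply _) continuous_const)
    (isClosed_iInter fun U => isClosed_iInter fun V => IsClosed.inter ?_ ?_)
  · exact isClosed_eq (continuous_apply _)
      (Continuous.comp (X := D → Bool) (f := fun f => (f U, f V))
        (continuous_of_discreteTopology (f := fun p : Bool × Bool => (p.1 || p.2)))
        ((continuous_apply U).prodMk (continuous_apply V)))
  · exact isClosed_eq (continuous_apply _)
      (Continuous.comp (X := D → Bool) (f := fun f => (f U, f V))
        (continuous_of_discreteTopology (f := fun p : Bool × Bool => (p.1 && p.2)))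
        ((continuous_apply U).prodMk (continuous_apply V)))

theorem exists_char {A B : D} (h : ¬ A ≤ B) :
    ∃ f ∈ Chars D, f A = true ∧ f B = false := by
  have hd : Disjoint (Order.PFilter.principal A : Set D) (Order.Ideal.principal B : Set D) := by
    rw [Set.disjoint_left]
    intro x hx hy
    exact h (le_trans (Order.PFilter.mem_principal.1 hx) (Order.Ideal.mem_principal.1 hy))
  obtain ⟨J, hJ, hI, hF⟩ := DistribLattice.prime_ideal_of_disjoint_filter_ideal hd
  refine ⟨fun U => decide (U ∉ J), ⟨?_, fun U V => ⟨?_, ?_⟩⟩, ?_, ?_⟩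
  · simp
  · by_cases hU : U ∈ J <;> by_cases hV : V ∈ J <;> simp [hU, hV, Order.Ideal.sup_mem_iff]
  · have : U ⊓ V ∈ J ↔ U ∈ J ∨ V ∈ J :=
      ⟨fun h => hJ.mem_or_mem h, fun h => h.elim (J.lower inf_le_left) (J.lower inf_le_right)⟩
    by_cases hU : U ∈ J <;> by_cases hV : V ∈ J <;> simp [hU, hV, this]
  · have : A ∉ J := fun hA =>
      Set.disjoint_left.1 hF (Order.PFilter.mem_principal.2 le_rfl) hA
    simpa using this
  · have : B ∈ J := hI Order.Ideal.mem_principal_self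
    simpa using this

/-- The class of the formal difference. -/
noncomputable def dd (A B : D) : Motive D := motiveOf A - motiveOf (A ⊓ B)

theorem dd_split (A B U : D) : dd A B = dd (A ⊓ U) B + dd A (B ⊔ U) := by
  have h := motiveOf_add (A ⊓ B) (A ⊓ U)
  rw [← inf_sup_left] at h
  have e : A ⊓ B ⊓ (A ⊓ U) = A ⊓ U ⊓ B := by
    rw [← inf_inf_distrib_left, inf_assoc, inf_comm B U]
  rw [e] at h
  unfold dd
  rw [← sub_eq_zero] at h ⊢
  rw [← neg_eq_zero, ← h]
  abel

theorem dd_of_le {A B : D} (h : A ≤ B) : dd A B = 0 := by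
  simp [dd, inf_eq_left.2 h]

/-- Value of a bool. -/
def bv (b : Bool) : ℤ := if b then 1 else 0

theorem key (L : List (ℤ × D)) : ∀ (A B : D) (c : ℤ),
    (∀ f ∈ Chars D, f A = true → f B = false →
      (L.map fun p => p.1 * bv (f p.2)).sum + c = 0) →
    (L.map fun p => p.1 • dd (A ⊓ p.2) B).sum + c • dd A B = 0 := by
  induction L with
  | nil =>
    intro A B c h
    by_cases hAB : A ≤ B
    · simp [dd_of_le hAB]
    · obtain ⟨f, hf, h1, h2⟩ := exists_char hAB
      have := h f hf h1 h2
      simp at this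
      simp [this]
  | cons p L ih =>
    obtain ⟨n, U⟩ := p
    intro A B c h
    have h1 := ih (A ⊓ U) B (n + c) (by
      intro f hf hA hB
      rw [(hf.2 _ _).2, Bool.and_eq_true] at hA
      have := h f hf hA.1 hB
      rw [List.map_cons, List.sum_cons] at this
      simp only [hA.2] at this
      have e1 : bv true = 1 := rfl
      have e2 : bv false = 0 := rfl
      simp only [e1, e2] at this
      linarith)
    have h2 := ih A (B ⊔ U) c (by
      intro f hf hA hB
      rw [(hf.2 _ _).1, Bool.or_eq_false_iff] at hB
      have := h f hf hA hB.1
      rw [List.map_cons, List.sum_cons] at this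
      simp only [hB.2] at this
      have e1 : bv true = 1 := rfl
      have e2 : bv false = 0 := rfl
      simp only [e1, e2] at this
      linarith)
    have e : (L.map fun p => p.1 • dd (A ⊓ p.2) B).sum =
        (L.map fun p => p.1 • dd (A ⊓ U ⊓ p.2) B).sum +
        (L.map fun p => p.1 • dd (A ⊓ p.2) (B ⊔ U)).sum := by
      rw [← List.sum_map_add]
      congr 1
      refine List.map_congr_left fun p _ => ?_
      rw [dd_split (A ⊓ p.2) B U, smul_add, inf_right_comm]
    rw [List.map_cons, List.sum_cons, e, dd_split A B U]
    have h3 := congrArg₂ (· + ·) h1 h2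
    simp only [add_zero] at h3
    rw [← h3, add_smul, smul_add]
    dsimp only
    abel

theorem exists_list (x : Motive D) : ∃ (L : List (ℤ × D)),
    x = (L.map fun p => p.1 • motiveOf p.2).sum := by
  obtain ⟨y, rfl⟩ := QuotientAddGroup.mk_surjective x
  induction y using FreeAbelianGroup.induction_on with
  | zero => exact ⟨[], rfl⟩
  | of U => exact ⟨[(1, U)], by simp; rfl⟩
  | neg U => exact ⟨[(-1, U)], by simp; rfl⟩
  | add a b ha hb =>
    obtain ⟨L, hL⟩ := ha
    obtain ⟨M, hM⟩ := hb
    refine ⟨L ++ M, ?_⟩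
    rw [List.map_append, List.sum_append, ← hL, ← hM]
    rfl

theorem exists_ub (L : List (ℤ × D)) : ∃ A : D, ∀ p ∈ L, p.2 ≤ A := by
  induction L with
  | nil => exact ⟨⊥, by simp⟩
  | cons p L ih =>
    obtain ⟨A, hA⟩ := ih
    refine ⟨p.2 ⊔ A, fun q hq => ?_⟩
    rcases List.mem_cons.1 hq with rfl | hq
    · exact le_sup_left
    · exact (hA q hq).trans le_sup_right

/-- The indicator of a lattice element. -/
noncomputable def ind (U : D) : LocallyConstant (Chars D) ℤ where
  toFun f := bv (f.1 U)
  isLocallyConstant := (IsLocallyConstant.iff_continuous _).2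
    ((continuous_of_discreteTopology (f := bv)).comp
      ((continuous_apply U).comp continuous_subtype_val))

/-- The realization map. -/
noncomputable def real : Motive D →+ LocallyConstant (Chars D) ℤ :=
  QuotientAddGroup.lift (motiveRelators D) (FreeAbelianGroup.lift ind) (by
    unfold motiveRelators
    rw [AddSubgroup.closure_le]
    rintro x (rfl | ⟨U, V, rfl⟩)
    · show FreeAbelianGroup.lift ind _ = 0
      ext f
      simp [ind, f.2.1, bv]
    · show FreeAbelianGroup.lift ind _ = 0
      ext f
      simp only [map_sub, map_add, FreeAbelianGroup.lift_apply_of]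
      show bv (f.1 U) + bv (f.1 V) - bv (f.1 (U ⊔ V)) - bv (f.1 (U ⊓ V)) = 0
      rw [(f.2.2 U V).1, (f.2.2 U V).2]
      cases f.1 U <;> cases f.1 V <;> simp [bv])

theorem real_of (U : D) : real (motiveOf U) = ind U :=
  FreeAbelianGroup.lift_apply_of _ _

theorem real_injective : Function.Injective (real (D := D)) := by
  rw [injective_iff_map_eq_zero]
  intro x hx
  obtain ⟨L, rfl⟩ := exists_list x
  obtain ⟨A, hA⟩ := exists_ub L
  have h := key L A ⊥ 0 (by
    intro f hf _ _
    have h1 := congrArg (fun g : LocallyConstant (Chars D) ℤ =>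
      LocallyConstant.evalAddMonoidHom (⟨f, hf⟩ : Chars D) g) hx
    simp only [map_list_sum, List.map_map, map_zero] at h1
    rw [add_zero, ← h1]
    congr 1
    refine List.map_congr_left fun p _ => ?_
    simp only [Function.comp, map_zsmul, real_of, smul_eq_mul]
    rfl)
  rw [zero_smul, add_zero] at h
  rw [← h]
  congr 1
  refine List.map_congr_left fun p hp => ?_
  simp [dd, inf_eq_right.2 (hA p hp), motiveOf_bot]

open Profinite.NobelingProof in
theorem free_aux {I : Type*} (C : Set (I → Bool)) (hC : IsClosed C) (z : C)
    (hz : ∀ i, z.1 i = false) (R : Submodule ℤ (LocallyConstant C ℤ))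
    (h0 : ∀ f ∈ R, f z = 0)
    (hp : ∀ l : List I, l ≠ [] → (l.map (e C)).prod ∈ R) : Module.Free ℤ R := by
  obtain ⟨_, _⟩ := exists_wellFoundedLT I
  let v : {l : {l : Products I // l.isGood C} // l.1.1 ≠ []} → LocallyConstant C ℤ :=
    fun l => GoodProducts.eval C l.1
  have hv : LinearIndependent ℤ v :=
    (GoodProducts.linearIndependent C hC).comp _ Subtype.val_injective
  have hsp : ∀ x : LocallyConstant C ℤ,
      x - (x z) • (1 : LocallyConstant C ℤ) ∈ Submodule.span ℤ (Set.range v) := by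
    intro x
    have hx : x ∈ Submodule.span ℤ (Set.range (GoodProducts.eval C)) :=
      GoodProducts.span C hC trivial
    induction hx using Submodule.span_induction with
    | mem x hx =>
      obtain ⟨l, rfl⟩ := hx
      by_cases hl : l.1.1 = []
      · have : GoodProducts.eval C l = 1 := by
          simp [GoodProducts.eval, Products.eval, hl]
        rw [this]
        simp
      · have : GoodProducts.eval C l z = 0 := by
          rw [GoodProducts.eval, Products.eval_eq, if_neg]
          intro h
          obtain ⟨i, hi⟩ := List.exists_mem_of_ne_nil _ hl
          have := h i hi
          rw [hz] at this
          exact Bool.noConfusion this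
        rw [this, zero_smul, sub_zero]
        exact Submodule.subset_span ⟨⟨l, hl⟩, rfl⟩
    | zero => simp
    | add x y _ _ hx hy =>
      have := add_mem hx hy
      rw [LocallyConstant.add_apply, add_smul]
      convert this using 1
      abel
    | smul n x _ hx =>
      have := Submodule.smul_mem _ n hx
      rw [smul_sub, smul_smul] at this
      exact this
  have hR : R = Submodule.span ℤ (Set.range v) := by
    apply le_antisymm
    · intro x hx
      have := hsp x
      rwa [h0 x hx, zero_smul, sub_zero] at this
    · rw [Submodule.span_le]
      rintro _ ⟨l, rfl⟩
      exact hp _ l.2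
  rw [hR]
  exact Module.Free.of_basis (Module.Basis.span hv)

theorem prod_mem (l : List D) (hl : l ≠ []) :
    ∃ U : D, (l.map (Profinite.NobelingProof.e (Chars D))).prod = ind U := by
  induction l with
  | nil => exact absurd rfl hl
  | cons V l ih =>
    by_cases h : l = []
    · subst h
      refine ⟨V, ?_⟩
      rw [List.map_cons, List.map_nil, List.prod_cons, List.prod_nil, mul_one]
      rfl
    · obtain ⟨U, hU⟩ := ih h
      refine ⟨V ⊓ U, ?_⟩
      rw [List.map_cons, List.prod_cons, hU]
      ext f
      show bv (f.1 V) * bv (f.1 U) = bv (f.1 (V ⊓ U))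
      rw [(f.2.2 V U).2]
      cases f.1 U <;> cases f.1 V <;> simp [bv]

end MotiveAux

/-- For every lower bounded distributive lattice `D`, the module of motives `M(D)`
is a free abelian group. -/
theorem motive_free (D : Type*) [DistribLattice D] [OrderBot D] :
    Module.Free ℤ (Motive D) := by
  let g : Motive D →ₗ[ℤ] LocallyConstant (MotiveAux.Chars D) ℤ :=
    { toFun := MotiveAux.real
      map_add' := map_add _
      map_smul' := fun n x => by
        rw [map_zsmul]
        ext f
        rfl }
  have hg : Function.Injective g := MotiveAux.real_injective
  have hr : Module.Free ℤ (LinearMap.range g) := by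
    refine MotiveAux.free_aux _ MotiveAux.isClosed_chars
      ⟨fun _ => false, rfl, fun _ _ => ⟨rfl, rfl⟩⟩ (fun _ => rfl) _ ?_ ?_
    · rintro _ ⟨x, rfl⟩
      obtain ⟨L, rfl⟩ := MotiveAux.exists_list x
      induction L with
      | nil =>
        rw [List.map_nil, List.sum_nil, map_zero]
        rfl
      | cons p L ih =>
        rw [List.map_cons, List.sum_cons, map_add, map_smul, LocallyConstant.add_apply, ih,
          add_zero]
        have : g (motiveOf p.2) = MotiveAux.ind p.2 := MotiveAux.real_of _
        rw [this]
        exact mul_zero _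
    · intro l hl
      obtain ⟨U, hU⟩ := MotiveAux.prod_mem l hl
      rw [hU]
      exact ⟨motiveOf U, MotiveAux.real_of _⟩
  exact Module.Free.of_equiv (LinearEquiv.ofInjective g hg).symm
end

section
/- Let D be a bounded distributive lattice and Bool(D) its Booleanization (the free Boolean algebra on D as a bounded distributive lattice). The canonical homomorphism D → Bool(D) induces an isomorphism M(D) ≅ M(Bool(D)) of motive modules; equivalently, every valuation on D extends uniquely to a valuation on Bool(D). -/
structure MGood {D : Type u} [DistribLattice D] [BoundedOrder D]
    {B : Type v} [BooleanAlgebra B] (η : BoundedLatticeHom D B)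
    {A : Type w} [AddCommGroup A] (μ : D → A) (G : Set (B × A)) : Prop where
  func : ∀ x a b, (x, a) ∈ G → (x, b) ∈ G → a = b
  modular : ∀ x a y b, (x, a) ∈ G → (y, b) ∈ G →
    ∃ c d, (x ⊔ y, c) ∈ G ∧ (x ⊓ y, d) ∈ G ∧ a + b = c + d
  uniq : ∀ ν : B → A, IsValuation ν → (∀ U, ν (η U) = μ U) → ∀ x a, (x, a) ∈ G → ν x = a

theorem MGood.step {D : Type u} [DistribLattice D] [BoundedOrder D]
    {B : Type v} [BooleanAlgebra B] {η : BoundedLatticeHom D B}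
    {A : Type w} [AddCommGroup A] {μ : D → A} {G : Set (B × A)} (hG : MGood η μ G)
    (c : B) (γ : A) (hc : (c, γ) ∈ G) :
    MGood η μ {z : B × A | ∃ p q, (z.1 ⊓ c, p) ∈ G ∧ (z.1 ⊔ c, q) ∈ G ∧ z.2 = p + q - γ} := by
  refine ⟨?_, ?_, ?_⟩
  · rintro x a b ⟨p, q, hp, hq, h⟩ ⟨p', q', hp', hq', h'⟩
    have e1 := hG.func _ _ _ hp hp'
    have e2 := hG.func _ _ _ hq hq'
    simp only at h h'
    rw [h, h', e1, e2]
  · rintro x a y b ⟨p, q, hp, hq, h⟩ ⟨p', q', hp', hq', h'⟩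
    obtain ⟨r, s, hr, hs, e⟩ := hG.modular _ _ _ _ hp hp'
    obtain ⟨r', s', hr', hs', e'⟩ := hG.modular _ _ _ _ hq hq'
    simp only at h h' hr hs hr' hs'
    rw [← inf_sup_right] at hr
    rw [← inf_inf_distrib_right] at hs
    rw [← sup_sup_distrib_right] at hr'
    rw [← sup_inf_right] at hs'
    refine ⟨r + r' - γ, s + s' - γ, ⟨r, r', hr, hr', rfl⟩, ⟨s, s', hs, hs', rfl⟩, ?_⟩
    have : a + b = (p + p') + (q + q') - γ - γ := by rw [h, h']; abel
    rw [this, e, e']; abel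
  · rintro ν hν hext x a ⟨p, q, hp, hq, h⟩
    have e1 := hG.uniq ν hν hext _ _ hp
    have e2 := hG.uniq ν hν hext _ _ hq
    have e3 := hG.uniq ν hν hext _ _ hc
    have e4 := hν.2 x c
    simp only at h e1 e2
    rw [h, ← e1, ← e2, ← e3, add_comm (ν (x ⊓ c)), ← e4]; abel

theorem bool_injective {D : Type u} [DistribLattice D] [BoundedOrder D]
    {B : Type v} [BooleanAlgebra B] (η : BoundedLatticeHom D B)
    (hUP : ∀ (C : Type v) [BooleanAlgebra C] (f : BoundedLatticeHom D C),
      ∃! g : BoundedLatticeHom B C, g.comp η = f) : Function.Injective η := by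
  have key : ∀ U V : D, η U = η V → U ≤ V := by
    intro U V h
    by_contra hUV
    obtain ⟨J, hJ, hIJ, hdis⟩ := DistribLattice.prime_ideal_of_disjoint_filter_ideal
      (F := Order.PFilter.principal U) (I := Order.Ideal.principal V) (by
        rw [Set.disjoint_left]
        intro x hx hx'
        exact hUV (le_trans (by simpa using hx) (by simpa using hx')))
    have hV : V ∈ J := hIJ (by simp)
    have hU : U ∉ J := Set.disjoint_left.1 hdis (by simp)
    let f : BoundedLatticeHom D (Set PUnit.{v+1}) :=
      { toFun := fun x => {_t | x ∉ J}
        map_sup' := by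
          intro a b
          ext t
          change (a ⊔ b ∉ J) ↔ (a ∉ J ∨ b ∉ J)
          rw [Order.Ideal.sup_mem_iff]; tauto
        map_inf' := by
          intro a b
          ext t
          change (a ⊓ b ∉ J) ↔ (a ∉ J ∧ b ∉ J)
          have h1 : a ⊓ b ∈ J → a ∈ J ∨ b ∈ J := hJ.mem_or_mem
          have h2 : a ∈ J → a ⊓ b ∈ J := fun h => J.lower inf_le_left h
          have h3 : b ∈ J → a ⊓ b ∈ J := fun h => J.lower inf_le_right h
          tauto
        map_top' := by
          ext t
          change (⊤ ∉ J) ↔ True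
          simp only [iff_true]
          exact hJ.toIsProper.top_notMem
        map_bot' := by
          ext t
          change (⊥ ∉ J) ↔ False
          simp }
    obtain ⟨g, hg, -⟩ := hUP _ f
    have e : f U = f V := by
      rw [← hg]; simp [h]
    have : U ∉ J ↔ V ∉ J := by
      have := congrArg (fun s => PUnit.unit ∈ s) e
      exact Iff.of_eq this
    tauto
  intro U V h
  exact le_antisymm (key U V h) (key V U h.symm)

theorem bool_generated {D : Type u} [DistribLattice D] [BoundedOrder D]
    {B : Type v} [BooleanAlgebra B] (η : BoundedLatticeHom D B)
    (hUP : ∀ (C : Type v) [BooleanAlgebra C] (f : BoundedLatticeHom D C),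
      ∃! g : BoundedLatticeHom B C, g.comp η = f)
    (L : BooleanSubalgebra B) (hL : ∀ U, η U ∈ L) (b : B) : b ∈ L := by
  let f : BoundedLatticeHom D L :=
    { toFun := fun x => ⟨η x, hL x⟩
      map_sup' := fun a b => Subtype.ext (map_sup η a b)
      map_inf' := fun a b => Subtype.ext (map_inf η a b)
      map_top' := Subtype.ext (map_top η)
      map_bot' := Subtype.ext (map_bot η) }
  obtain ⟨g, hg, -⟩ := hUP _ f
  have h1 : (L.subtype.comp g).comp η = η := by
    rw [BoundedLatticeHom.comp_assoc, hg]
    rfl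
  have h2 : L.subtype.comp g = BoundedLatticeHom.id B :=
    (hUP B η).unique h1 (BoundedLatticeHom.id_comp η)
  have h3 : ((g b : L) : B) = b := DFunLike.congr_fun h2 b
  rw [← h3]
  exact (g b).2

theorem valuation_extends {D : Type u} [DistribLattice D] [BoundedOrder D]
    {B : Type v} [BooleanAlgebra B] (η : BoundedLatticeHom D B)
    (hUP : ∀ (C : Type v) [BooleanAlgebra C] (f : BoundedLatticeHom D C),
      ∃! g : BoundedLatticeHom B C, g.comp η = f)
    (A : Type w) [AddCommGroup A] (μ : D → A) (hμ : IsValuation μ) :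
    ∃! ν : B → A, IsValuation ν ∧ ∀ U : D, ν (η U) = μ U := by
  have hinj := bool_injective η hUP
  have h0 : MGood η μ (Set.range fun U => (η U, μ U)) := by
    refine ⟨?_, ?_, ?_⟩
    · rintro x a b ⟨U, hU⟩ ⟨V, hV⟩
      simp only [Prod.mk.injEq] at hU hV
      have : U = V := hinj (hU.1.trans hV.1.symm)
      rw [← hU.2, ← hV.2, this]
    · rintro x a y b ⟨U, hU⟩ ⟨V, hV⟩
      simp only [Prod.mk.injEq] at hU hV
      obtain ⟨rfl, rfl⟩ := hU
      obtain ⟨rfl, rfl⟩ := hV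
      exact ⟨μ (U ⊔ V), μ (U ⊓ V), ⟨U ⊔ V, by simp⟩, ⟨U ⊓ V, by simp⟩, hμ.2 U V⟩
    · rintro ν hν hext x a ⟨U, hU⟩
      simp only [Prod.mk.injEq] at hU
      rw [← hU.1, ← hU.2, hext]
  obtain ⟨G, h0G, hmax⟩ := zorn_subset_nonempty {G | MGood η μ G} (by
    intro c hcS hc hne
    refine ⟨⋃₀ c, ?_, fun s hs => Set.subset_sUnion_of_mem hs⟩
    refine ⟨?_, ?_, ?_⟩
    · rintro x a b ⟨s, hs, hxs⟩ ⟨t, ht, hxt⟩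
      rcases hc.total hs ht with h | h
      · exact (hcS ht).func _ _ _ (h hxs) hxt
      · exact (hcS hs).func _ _ _ hxs (h hxt)
    · rintro x a y b ⟨s, hs, hxs⟩ ⟨t, ht, hxt⟩
      obtain ⟨r, hr, hx, hy⟩ : ∃ r ∈ c, (x, a) ∈ r ∧ (y, b) ∈ r := by
        rcases hc.total hs ht with h | h
        · exact ⟨t, ht, h hxs, hxt⟩
        · exact ⟨s, hs, hxs, h hxt⟩
      obtain ⟨p, q, hp, hq, e⟩ := (hcS hr).modular _ _ _ _ hx hy
      exact ⟨p, q, ⟨r, hr, hp⟩, ⟨r, hr, hq⟩, e⟩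
    · rintro ν hν hext x a ⟨s, hs, hxs⟩
      exact (hcS hs).uniq ν hν hext _ _ hxs) _ h0
  have hG : MGood η μ G := hmax.prop
  have hmem : ∀ U, (η U, μ U) ∈ G := fun U => h0G ⟨U, rfl⟩
  have hcompl : ∀ c γ, (c, γ) ∈ G → ∃ a, (cᶜ, a) ∈ G := by
    intro c γ hc
    have hst := hG.step c γ hc
    have hsub := hmax.le_of_ge hst (by
      rintro ⟨x, a⟩ hx
      obtain ⟨p, q, hp, hq, e⟩ := hG.modular _ _ _ _ hx hc
      exact ⟨q, p, hq, hp, by simp only; rw [add_comm q p, ← e]; abel⟩)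
    refine ⟨0 + μ ⊤ - γ, hsub ⟨0, μ ⊤, ?_, ?_, rfl⟩⟩
    · have := hmem ⊥
      rw [map_bot, hμ.1] at this
      simpa using this
    · have := hmem ⊤
      rw [map_top] at this
      simpa using this
  let L : BooleanSubalgebra B :=
    { carrier := {x | ∃ a, (x, a) ∈ G}
      supClosed' := by
        rintro x ⟨a, ha⟩ y ⟨b, hb⟩
        obtain ⟨p, q, hp, hq, e⟩ := hG.modular _ _ _ _ ha hb
        exact ⟨p, hp⟩
      infClosed' := by
        rintro x ⟨a, ha⟩ y ⟨b, hb⟩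
        obtain ⟨p, q, hp, hq, e⟩ := hG.modular _ _ _ _ ha hb
        exact ⟨q, hq⟩
      compl_mem' := by
        rintro x ⟨a, ha⟩
        exact hcompl x a ha
      bot_mem' := ⟨μ ⊥, by simpa using hmem ⊥⟩ }
  have htot : ∀ b : B, ∃ a, (b, a) ∈ G :=
    fun b => bool_generated η hUP L (fun U => ⟨μ U, hmem U⟩) b
  choose ν hν using htot
  have hνη : ∀ U, ν (η U) = μ U := fun U => hG.func _ _ _ (hν _) (hmem U)
  refine ⟨ν, ⟨⟨?_, ?_⟩, hνη⟩, ?_⟩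
  · rw [← map_bot η, hνη, hμ.1]
  · intro U V
    obtain ⟨p, q, hp, hq, e⟩ := hG.modular _ _ _ _ (hν U) (hν V)
    rw [e, hG.func _ _ _ hp (hν _), hG.func _ _ _ hq (hν _)]
  · rintro ν' ⟨h1, h2⟩
    funext x
    exact hG.uniq ν' h1 h2 _ _ (hν x)

theorem motiveOf_isValuation {D : Type u} [DistribLattice D] [OrderBot D] :
    IsValuation (motiveOf : D → Motive D) := by
  constructor
  · exact (QuotientAddGroup.eq_zero_iff _).2 (AddSubgroup.subset_closure (Or.inl rfl))
  · intro U V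
    rw [← sub_eq_zero, ← sub_sub]
    exact (QuotientAddGroup.eq_zero_iff (N := motiveRelators D) _).2
      (AddSubgroup.subset_closure (Or.inr ⟨U, V, rfl⟩))

theorem motive_lift {D : Type u} [DistribLattice D] [OrderBot D] {A : Type w} [AddCommGroup A]
    (μ : D → A) (hμ : IsValuation μ) : ∃ f : Motive D →+ A, ∀ U, f (motiveOf U) = μ U := by
  refine ⟨QuotientAddGroup.lift (motiveRelators D) (FreeAbelianGroup.lift μ) ?_, ?_⟩
  · unfold motiveRelators
    rw [AddSubgroup.closure_le]
    rintro x (rfl | ⟨U, V, rfl⟩)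
    · simp [hμ.1]
    · simp [hμ.2 U V]
  · intro U
    exact FreeAbelianGroup.lift_apply_of μ U

theorem motive_ext {D : Type u} [DistribLattice D] [OrderBot D] {A : Type w} [AddCommGroup A]
    (f g : Motive D →+ A) (h : ∀ U, f (motiveOf U) = g (motiveOf U)) : f = g := by
  apply QuotientAddGroup.addMonoidHom_ext (motiveRelators D)
  apply FreeAbelianGroup.lift_ext
  exact h

/-- Let `D` be a bounded distributive lattice and `η : D → B` its Booleanization,
i.e. `B` is a Boolean algebra and `η` a bounded lattice homomorphism satisfying the
universal property of the free Boolean algebra on `D`.  Then `η` induces an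
isomorphism `M(D) ≅ M(B)` of motive modules; equivalently, every valuation on `D`
extends uniquely to a valuation on `B = Bool(D)`. -/
theorem motive_booleanization {D : Type u} [DistribLattice D] [BoundedOrder D]
    {B : Type v} [BooleanAlgebra B] (η : BoundedLatticeHom D B)
    (hUP : ∀ (C : Type v) [BooleanAlgebra C] (f : BoundedLatticeHom D C),
      ∃! g : BoundedLatticeHom B C, g.comp η = f) :
    (∃ e : Motive D ≃+ Motive B, ∀ U : D, e (motiveOf U) = motiveOf (η U)) ∧
      ∀ (A : Type w) [AddCommGroup A] (μ : D → A), IsValuation μ →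
        ∃! ν : B → A, IsValuation ν ∧ ∀ U : D, ν (η U) = μ U := by
  refine ⟨?_, fun A _ μ hμ => valuation_extends η hUP A μ hμ⟩
  obtain ⟨f, hf⟩ := motive_lift (fun U : D => (motiveOf (η U) : Motive B)) (by
    constructor
    · simp only [map_bot]; exact motiveOf_isValuation.1
    · intro U V
      simp only [map_sup, map_inf]
      exact motiveOf_isValuation.2 _ _)
  obtain ⟨ν, ⟨hν, hνη⟩, -⟩ := valuation_extends η hUP (Motive D) motiveOf motiveOf_isValuation
  obtain ⟨g, hg⟩ := motive_lift ν hν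
  have h1 : g.comp f = AddMonoidHom.id _ := by
    apply motive_ext
    intro U
    simp [hf, hg, hνη]
  have h2 : f.comp g = AddMonoidHom.id _ := by
    apply motive_ext
    intro b
    have hval : IsValuation (fun b => f (ν b)) := by
      constructor
      · simp [hν.1]
      · intro U V
        simp only [← map_add, hν.2 U V]
    have hu := (valuation_extends η hUP (Motive B) (fun U => f (motiveOf U)) (by
      constructor
      · simp [motiveOf_isValuation.1]
      · intro U V
        simp only [← map_add, motiveOf_isValuation.2 U V])).unique
      (y₁ := fun b => f (ν b)) (y₂ := motiveOf)
      ⟨hval, fun U => by simp only [hνη]⟩ ⟨motiveOf_isValuation, fun U => (hf U).symm⟩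
    have := congrFun hu b
    simpa [hg] using this
  exact ⟨AddMonoidHom.toAddEquiv f g h1 h2, hf⟩
end
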